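/- arXiv:math/0610815 — 2 statements merged into one kernel-verified Lean document; each statement's English description precedes it below -/
import Mathlib

section
/- Dissipation estimate: for every solution a(t) of the dyadic system with a(0) ∈ ℓ², a_j(0) ≥ 0, and every 0 ≤ t₁ ≤ t₂, the deviation b = a − â from the fixed point satisfies |b(t₂)|² − |b(t₁)|² ≤ −α ∫_{t₁}^{t₂} |d(t)|² dt, where α = 2 − λ^{3/8} ∈ (0,1), λ = 2^{5/2}, and d is the differenced sequence. -/
open Real Set MeasureTheory Finset Filter

noncomputable def lam : ℝ := (2:ℝ) ^ ((5:ℝ)/2)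

/-- Right-hand side of the dyadic system: `da_j/dt = λ^{j-1} a_{j-1}² − λ^j a_j a_{j+1} + f_j`
with `a_{-1}=0`, forcing `f_0 > 0`, `f_j = 0` for `j ≥ 1`. -/
noncomputable def dyadicRHS (f0 : ℝ) (a : ℕ → ℝ) : ℕ → ℝ
  | 0 => -(a 0 * a 1) + f0
  | (j+1) => lam ^ j * (a j)^2 - lam ^ (j+1) * a (j+1) * a (j+2)

/-- A weak (= classical) solution of the dyadic system on `[0,∞)`: an `ℓ²`-valued
function whose components are differentiable and satisfy the ODEs. -/
def IsDyadicSolution (f0 : ℝ) (a : ℝ → ℕ → ℝ) : Prop :=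
  (∀ t ∈ Ici (0:ℝ), Summable (fun j => (a t j)^2)) ∧
  (∀ j, ∀ t ∈ Ici (0:ℝ), HasDerivWithinAt (fun s => a s j) (dyadicRHS f0 (a t) j) (Ici 0) t)

/-- Deviation from the fixed point: `b_j = a_j − λ^{−j/3}`. -/
noncomputable def bvar (a : ℝ → ℕ → ℝ) (t : ℝ) (j : ℕ) : ℝ := a t j - lam ^ (-(j:ℝ)/3)

/-- Differenced variables: `d_0 = λ^{−1/6} b_0`, `d_j = λ^{(j−1)/3}(λ^{1/6} b_j − λ^{−1/6} b_{j−1})`. -/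
noncomputable def dvar (a : ℝ → ℕ → ℝ) (t : ℝ) : ℕ → ℝ
  | 0 => lam ^ (-(1:ℝ)/6) * bvar a t 0
  | (i+1) => lam ^ ((i:ℝ)/3) * (lam ^ ((1:ℝ)/6) * bvar a t (i+1) - lam ^ (-(1:ℝ)/6) * bvar a t i)


lemma exists_q : ∃ q : ℝ, 1 < q ∧ q < 2 ∧ lam = q ^ 6 ∧ lam ^ (-(1:ℝ)/3) = (q^2)⁻¹ ∧
    (∀ j : ℕ, lam ^ (-(j:ℝ)/3) = (q^(2*j))⁻¹) ∧ lam ^ (-(1:ℝ)/6) = q⁻¹ ∧ lam ^ ((1:ℝ)/6) = q ∧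
    (∀ j : ℕ, lam ^ ((j:ℝ)/3) = q^(2*j)) := by
  refine ⟨(2:ℝ) ^ ((5:ℝ)/12), ?_, ?_, ?_, ?_, ?_, ?_, ?_, ?_⟩
  · exact Real.one_lt_rpow (by norm_num) (by norm_num)
  · conv_rhs => rw [← Real.rpow_one (2:ℝ)]
    exact Real.rpow_lt_rpow_of_exponent_lt (by norm_num) (by norm_num)
  · rw [lam, ← Real.rpow_natCast, ← Real.rpow_mul (by norm_num)]; norm_num
  · rw [lam, ← Real.rpow_natCast, ← Real.rpow_mul (by norm_num), ← Real.rpow_mul (by norm_num),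
      ← Real.rpow_neg (by norm_num)]; norm_num
  · intro j
    rw [lam, ← Real.rpow_natCast, ← Real.rpow_mul (by norm_num), ← Real.rpow_mul (by norm_num),
      ← Real.rpow_neg (by norm_num)]; congr 1; push_cast; ring
  · rw [lam, ← Real.rpow_mul (by norm_num), ← Real.rpow_neg (by norm_num)]; norm_num
  · rw [lam, ← Real.rpow_mul (by norm_num)]; norm_num
  · intro j
    rw [lam, ← Real.rpow_natCast, ← Real.rpow_mul (by norm_num), ← Real.rpow_mul (by norm_num)]
    congr 1; push_cast; ring

lemma lam_coeff : 1 ≤ lam ^ ((3:ℝ)/8) := by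
  rw [lam, ← Real.rpow_mul (by norm_num)]
  exact Real.one_le_rpow (by norm_num) (by norm_num)

lemma ftc_aux (f f' : ℝ → ℝ) (s t : ℝ) (hs : 0 ≤ s) (hst : s ≤ t)
    (h : ∀ x ∈ Ici (0:ℝ), HasDerivWithinAt f (f' x) (Ici 0) x) (hc : ContinuousOn f' (Ici 0)) :
    ∫ x in s..t, f' x = f t - f s := by
  have hsub : Icc s t ⊆ Ici (0:ℝ) := fun x hx => le_trans hs hx.1
  apply intervalIntegral.integral_eq_sub_of_hasDeriv_right_of_le hst
  · exact fun x hx => ((h x (hsub hx)).continuousWithinAt).mono hsub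
  · intro x hx
    exact (h x (le_trans hs hx.1.le)).mono (fun y hy => le_trans (le_trans hs hx.1.le) (le_of_lt hy))
  · exact (hc.mono (by rw [uIcc_of_le hst]; exact hsub)).intervalIntegrable

lemma seq_bound (S : ℕ → ℝ) (K C q : ℝ) (hq0 : 0 < q) (hq : q < 2) 
    (h1 : ∀ N, 2 * S N ≤ S (N+1) + K) (h2 : ∀ N, S N ≤ C * q ^ N + K) (N : ℕ) : S N ≤ K := by
  have h3 : ∀ k, S N - K ≤ (S (N+k) - K) / 2^k := by
    intro k
    induction k with
    | zero => simp
    | succ k ih =>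
      refine ih.trans ?_
      rw [pow_succ, mul_comm ((2:ℝ)^k), ← div_div]
      gcongr
      have := h1 (N+k)
      rw [← add_assoc]; linarith
  have h4 : ∀ k, S N - K ≤ (C * q^N) * (q/2)^k := by
    intro k
    refine (h3 k).trans ?_
    rw [div_pow, mul_div_assoc', mul_assoc, ← pow_add]
    gcongr
    linarith [h2 (N+k)]
  have h5 : Tendsto (fun k : ℕ => (C * q^N) * (q/2)^k) atTop (nhds 0) := by
    simpa using (tendsto_pow_atTop_nhds_zero_of_lt_one (by positivity) (by linarith : q/2 < 1)).const_mul (C * q^N)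
  linarith [ge_of_tendsto' h5 h4]

lemma rhs_identity (q : ℝ) (hq : q ≠ 0) (hl : lam = q^6) (x b d : ℕ → ℝ)
    (hb : ∀ j, b j = x j - (q^(2*j))⁻¹) (hd0 : d 0 = q⁻¹ * b 0)
    (hd : ∀ j, d (j+1) = q^(2*j) * (q * b (j+1) - q⁻¹ * b j)) (N : ℕ) :
    ∑ j ∈ range (N+1), 2 * b j * dyadicRHS ((q^2)⁻¹) x j =
      - 2 * (q^6)^N * (b N)^2 * x (N+1) + (d (N+1))^2 - (q^(2*N) * q * b (N+1))^2
        - ∑ j ∈ range (N+1), (d j)^2 := by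
  induction N with
  | zero =>
    simp [dyadicRHS, hd, hd0, hb, hl]
    field_simp
    ring
  | succ N ih =>
    rw [Finset.sum_range_succ, ih, Finset.sum_range_succ _ (N+1)]
    simp only [dyadicRHS, hd, hl]
    have e1 : x N = b N + (q^(2*N))⁻¹ := by rw [hb]; ring
    have e2 : x (N+1) = b (N+1) + (q^(2*(N+1)))⁻¹ := by rw [hb]; ring
    have e3 : x (N+2) = b (N+2) + (q^(2*(N+2)))⁻¹ := by rw [hb]; ring
    rw [show N+1+1 = N+2 from rfl, e1, e2, e3]
    have f1 : (q^6)^N = (q^(2*N))^3 := by rw [← pow_mul, ← pow_mul]; congr 1; ring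
    have f2 : q^(2*(N+1)) = q^(2*N) * q^2 := by rw [← pow_add]; congr 1
    have f3 : q^(2*(N+2)) = q^(2*N) * q^4 := by rw [← pow_add]; congr 1
    have hu : q^(2*N) ≠ 0 := pow_ne_zero _ hq
    rw [pow_succ (q^6), f1, f2, f3]
    generalize q^(2*N) = u at hu ⊢
    field_simp
    ring

lemma energy_identity (f0 : ℝ) (x : ℕ → ℝ) (N : ℕ) :
    ∑ j ∈ range (N+1), 2 * x j * dyadicRHS f0 x j =
      - 2 * (lam^N * ((x N)^2 * x (N+1))) + 2 * f0 * x 0 := by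
  induction N with
  | zero => simp [dyadicRHS]; ring
  | succ N ih =>
    rw [Finset.sum_range_succ, ih]
    simp only [dyadicRHS, pow_succ]
    ring

lemma pos_aux (f g r : ℝ → ℝ) (hg : ContinuousOn g (Ici 0)) (h0 : 0 ≤ f 0) 
    (hf : ∀ t ∈ Ici (0:ℝ), HasDerivWithinAt f (r t - g t * f t) (Ici 0) t)
    (hr : ∀ t, 0 ≤ t → 0 ≤ r t) (t : ℝ) (ht : 0 ≤ t) : 0 ≤ f t := by
  have hgc : Continuous (fun s => g (max s 0)) := by
    rw [← continuousOn_univ]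
    exact hg.comp (by fun_prop) (fun s _ => mem_Ici.2 (le_max_right _ _))
  let G : ℝ → ℝ := fun t => ∫ s in (0:ℝ)..t, g (max s 0)
  have hG : ∀ t, HasDerivAt G (g (max t 0)) t := fun t =>
    intervalIntegral.integral_hasDerivAt_right (hgc.intervalIntegrable _ _)
      (hgc.stronglyMeasurableAtFilter _ _) hgc.continuousAt
  have hd : ∀ t ∈ Ici (0:ℝ), HasDerivWithinAt (fun t => f t * Real.exp (G t))
      (r t * Real.exp (G t)) (Ici 0) t := by
    intro t ht
    have := (hf t ht).mul ((hG t).exp.hasDerivWithinAt (s := Ici 0))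
    refine HasDerivWithinAt.congr_deriv this ?_
    rw [max_eq_left (mem_Ici.1 ht)]; ring
  have hm : MonotoneOn (fun t => f t * Real.exp (G t)) (Ici 0) := by
    apply monotoneOn_of_hasDerivWithinAt_nonneg (convex_Ici 0)
    · exact fun t ht => (hd t ht).continuousWithinAt
    · intro x hx
      exact (hd x (interior_subset hx)).mono interior_subset
    · intro x hx
      have := hr x (interior_subset hx)
      positivity
  have h := hm (self_mem_Ici (a := (0:ℝ))) ht ht
  have h' : 0 ≤ f t * Real.exp (G t) := le_trans (mul_nonneg h0 (Real.exp_pos _).le) h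
  exact nonneg_of_mul_nonneg_left h' (Real.exp_pos _)

lemma sol_cont {f0 : ℝ} {a : ℝ → ℕ → ℝ} (ha : IsDyadicSolution f0 a) (j : ℕ) :
    ContinuousOn (fun s => a s j) (Ici 0) := fun t ht => (ha.2 j t ht).continuousWithinAt

lemma sol_pos {f0 : ℝ} {a : ℝ → ℕ → ℝ} (ha : IsDyadicSolution f0 a) (hf : 0 ≤ f0) 
    (hl : 0 < lam) (h0 : ∀ j, 0 ≤ a 0 j) (j : ℕ) (t : ℝ) (ht : 0 ≤ t) : 0 ≤ a t j := by
  cases j with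
  | zero =>
    refine pos_aux (fun s => a s 0) (fun s => a s 1) (fun _ => f0) (sol_cont ha 1) (h0 0) ?_
      (fun _ _ => hf) t ht
    intro t ht
    convert ha.2 0 t ht using 1
    simp [dyadicRHS]; ring
  | succ j =>
    refine pos_aux (fun s => a s (j+1)) (fun s => lam^(j+1) * a s (j+2))
      (fun s => lam^j * (a s j)^2) (continuousOn_const.mul (sol_cont ha (j+2))) (h0 _) ?_
      (fun _ _ => by positivity) t ht
    intro t ht
    convert ha.2 (j+1) t ht using 1
    simp [dyadicRHS]; ring

lemma sol_rhs_cont {f0 : ℝ} {a : ℝ → ℕ → ℝ} (ha : IsDyadicSolution f0 a) (j : ℕ) :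
    ContinuousOn (fun s => dyadicRHS f0 (a s) j) (Ici 0) := by
  have hc := sol_cont ha
  cases j with
  | zero => 
    simp only [dyadicRHS]
    exact ((hc 0).mul (hc 1)).neg.add continuousOn_const
  | succ j =>
    simp only [dyadicRHS]
    exact (continuousOn_const.mul ((hc j).pow 2)).sub
      ((continuousOn_const.mul (hc (j+1))).mul (hc (j+2)))

lemma integrable_tsum_aux {μ : Measure ℝ} (F : ℕ → ℝ → ℝ) (hF : ∀ i, Integrable (F i) μ)
    (h0 : ∀ i x, 0 ≤ F i x) (hs : Summable (fun i => ∫ x, F i x ∂μ)) :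
    Integrable (fun x => ∑' i, F i x) μ ∧
      HasSum (fun i => ∫ x, F i x ∂μ) (∫ x, ∑' i, F i x ∂μ) := by
  constructor
  · have h1 : (fun x => ∑' i, F i x) = fun x => (∑' i, ENNReal.ofReal (F i x)).toReal := by
      ext x
      rw [ENNReal.tsum_toReal_eq (fun i => ENNReal.ofReal_ne_top)]
      simp [ENNReal.toReal_ofReal (h0 _ x)]
    rw [h1]
    apply integrable_toReal_of_lintegral_ne_top
    · exact AEMeasurable.tsum (fun i => (hF i).aemeasurable.ennreal_ofReal)
    · rw [lintegral_tsum (fun i => (hF i).aemeasurable.ennreal_ofReal)]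
      have : ∀ i, ∫⁻ x, ENNReal.ofReal (F i x) ∂μ = ENNReal.ofReal (∫ x, F i x ∂μ) := fun i =>
        (ofReal_integral_eq_lintegral_ofReal (hF i) (Eventually.of_forall (h0 i))).symm
      simp_rw [this]
      exact hs.tsum_ofReal_ne_top
  · apply hasSum_integral_of_summable_integral_norm hF
    simpa [abs_of_nonneg (h0 _ _)] using hs

lemma cont_ii {f : ℝ → ℝ} (hf : ContinuousOn f (Ici 0)) {s t : ℝ} (hs : 0 ≤ s) (ht : s ≤ t) :
    IntervalIntegrable f volume s t :=
  (hf.mono (by rw [uIcc_of_le ht]; exact fun x hx => mem_Ici.2 (le_trans hs hx.1))).intervalIntegrable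

lemma energy_bound {f0 : ℝ} {a : ℝ → ℕ → ℝ} (ha : IsDyadicSolution f0 a) (hf : 0 ≤ f0) 
    (hl : 0 < lam) (hp : ∀ j t, 0 ≤ t → 0 ≤ a t j) (t1 t2 : ℝ) (h1 : 0 ≤ t1) (h12 : t1 ≤ t2) :
    ∃ C, 0 ≤ C ∧ ∀ N, (∀ t ∈ Icc t1 t2, a t N ≤ C) ∧
      lam^N * ∫ t in t1..t2, (a t N)^2 * a t (N+1) ≤ C := by
  have hc := sol_cont ha
  obtain ⟨M, hM⟩ := isCompact_Icc.exists_bound_of_continuousOn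
    ((hc 0).mono (fun x hx => mem_Ici.2 (le_trans h1 hx.1) : Icc t1 t2 ⊆ Ici 0))
  have hM0 : 0 ≤ M := (norm_nonneg _).trans (hM t1 ⟨le_rfl, h12⟩)
  set T := ∑' j, (a t1 j)^2 with hT
  have hT0 : 0 ≤ T := tsum_nonneg (fun j => sq_nonneg _)
  have hd0 : 0 ≤ t2 - t1 := by linarith
  have key : ∀ N, ∀ t ∈ Icc t1 t2, ∑ j ∈ range (N+1), (a t j)^2 +
      2 * (lam^N * ∫ t in t1..t, (a t N)^2 * a t (N+1)) ≤ T + 2 * f0 * (M * (t2 - t1)) := by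
    intro N t ht
    have hflux : ContinuousOn (fun t => (a t N)^2 * a t (N+1)) (Ici 0) := ((hc N).fun_pow 2).fun_mul (hc _)
    have e := ftc_aux (fun t => ∑ j ∈ range (N+1), (a t j)^2)
      (fun t => - 2 * (lam^N * ((a t N)^2 * a t (N+1))) + 2 * f0 * a t 0) t1 t h1 ht.1 (by
        intro x hx
        refine HasDerivWithinAt.congr_deriv (HasDerivWithinAt.fun_sum
          (fun j _ => (ha.2 j x hx).fun_pow 2)) ?_
        rw [← energy_identity f0 (a x) N]
        apply Finset.sum_congr rfl
        intros; simp) (by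
        exact (continuousOn_const.fun_mul (continuousOn_const.fun_mul hflux)).fun_add
          (continuousOn_const.fun_mul (hc 0)))
    rw [intervalIntegral.integral_add
      (cont_ii (continuousOn_const.fun_mul (continuousOn_const.fun_mul hflux)) h1 ht.1)
      (cont_ii (continuousOn_const.fun_mul (hc 0)) h1 ht.1)] at e
    simp only [intervalIntegral.integral_const_mul] at e
    have i0 : ∫ x in t1..t, a x 0 ≤ M * (t2 - t1) := by
      have : ∫ x in t1..t, a x 0 ≤ ∫ x in t1..t, M := by
        apply intervalIntegral.integral_mono_on ht.1 (cont_ii (hc 0) h1 ht.1) (by simp)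
        intro x hx
        exact (le_abs_self _).trans (hM x ⟨hx.1, hx.2.trans ht.2⟩)
      rw [intervalIntegral.integral_const, smul_eq_mul] at this
      nlinarith [ht.2]
    have s0 : ∑ j ∈ range (N+1), (a t1 j)^2 ≤ T :=
      (ha.1 t1 h1).sum_le_tsum _ (fun j _ => sq_nonneg _)
    have := mul_le_mul_of_nonneg_left i0 (by positivity : 0 ≤ 2 * f0)
    linarith
  refine ⟨T + 2 * f0 * (M * (t2 - t1)) + 1, by positivity, fun N => ⟨fun t ht => ?_, ?_⟩⟩
  · have k := key N t ht
    have hi : 0 ≤ ∫ t in t1..t, (a t N)^2 * a t (N+1) :=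
      intervalIntegral.integral_nonneg ht.1
        (fun x hx => mul_nonneg (sq_nonneg _) (hp _ _ (h1.trans hx.1)))
    have hi2 : 0 ≤ lam^N * ∫ t in t1..t, (a t N)^2 * a t (N+1) := by positivity
    have : (a t N)^2 ≤ ∑ j ∈ range (N+1), (a t j)^2 :=
      Finset.single_le_sum (f := fun j => (a t j)^2) (fun j _ => sq_nonneg _) (by simp)
    nlinarith [sq_nonneg (a t N - 1)]
  · have k := key N t2 ⟨h12, le_rfl⟩
    have : 0 ≤ ∑ j ∈ range (N+1), (a t2 j)^2 := Finset.sum_nonneg (fun j _ => sq_nonneg _)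
    have hi : 0 ≤ ∫ t in t1..t2, (a t N)^2 * a t (N+1) :=
      intervalIntegral.integral_nonneg h12
        (fun x hx => mul_nonneg (sq_nonneg _) (hp _ _ (h1.trans hx.1)))
    have hi2 : 0 ≤ lam^N * ∫ t in t1..t2, (a t N)^2 * a t (N+1) := by positivity
    linarith

lemma shell_bound {f0 : ℝ} {a : ℝ → ℕ → ℝ} (ha : IsDyadicSolution f0 a) (hf : 0 ≤ f0) 
    (q : ℝ) (hq : 1 < q) (hl : lam = q^6) (hp : ∀ j t, 0 ≤ t → 0 ≤ a t j)
    (t1 t2 : ℝ) (h1 : 0 ≤ t1) (h12 : t1 ≤ t2) :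
    ∃ C, 0 ≤ C ∧ ∀ N, q^(3*N) * ∫ t in t1..t2, (a t N)^2 ≤ C := by
  have hq0 : 0 < q := by linarith
  have hlp : 0 < lam := by rw [hl]; positivity
  have hc := sol_cont ha
  have hT : 0 ≤ t2 - t1 := by linarith
  obtain ⟨C, hC0, hC⟩ := energy_bound ha hf hlp hp t1 t2 h1 h12
  refine ⟨C + q^3 * (C * C + (t2 - t1)), by positivity, fun N => ?_⟩
  -- bound on ∫ a_M a_{M+1}
  have i1 : ∀ M, q^(3*M) * ∫ t in t1..t2, a t M * a t (M+1) ≤ C * C + (t2 - t1) := by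
    intro M
    have hflux : ContinuousOn (fun t => (a t M)^2 * a t (M+1)) (Ici 0) := ((hc M).fun_pow 2).fun_mul (hc _)
    have : ∫ t in t1..t2, q^(3*M) * (a t M * a t (M+1)) ≤
        ∫ t in t1..t2, (C * lam^M) * ((a t M)^2 * a t (M+1)) + 1 := by
      apply intervalIntegral.integral_mono_on h12
        (cont_ii (continuousOn_const.fun_mul ((hc _).fun_mul (hc _))) h1 h12)
        (cont_ii ((continuousOn_const.fun_mul hflux).fun_add continuousOn_const) h1 h12)
      intro x hx
      have hx0 := h1.trans hx.1
      have e : lam^M = (q^(3*M))^2 := by rw [hl, ← pow_mul, ← pow_mul]; congr 1; ring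
      rw [e]
      have p1 := hp M x hx0
      have p2 := hp (M+1) x hx0
      have p3 := (hC (M+1)).1 x hx
      generalize q^(3*M) = v
      have : v^2 * ((a x M)^2 * a x (M+1)) * a x (M+1) ≤ v^2 * ((a x M)^2 * a x (M+1)) * C :=
        mul_le_mul_of_nonneg_left p3 (by positivity)
      nlinarith [sq_nonneg (v * (a x M * a x (M+1)) - 1), sq_nonneg (v * (a x M * a x (M+1)))]
    rw [intervalIntegral.integral_add (cont_ii (continuousOn_const.fun_mul hflux) h1 h12) (by simp)] at this
    simp only [intervalIntegral.integral_const_mul, intervalIntegral.integral_const, smul_eq_mul] at this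
    have h := mul_le_mul_of_nonneg_left (hC M).2 hC0
    nlinarith
  have e := ftc_aux (fun t => a t (N+1)) (fun t => lam^N * (a t N)^2 - lam^(N+1) * (a t (N+1) * a t (N+2)))
    t1 t2 h1 h12 (by
      intro x hx
      refine HasDerivWithinAt.congr_deriv (ha.2 (N+1) x hx) ?_
      simp only [dyadicRHS]; ring)
    ((continuousOn_const.fun_mul ((hc _).fun_pow 2)).fun_sub (continuousOn_const.fun_mul ((hc _).fun_mul (hc _))))
  rw [intervalIntegral.integral_sub
      (cont_ii (continuousOn_const.fun_mul ((hc _).fun_pow 2)) h1 h12)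
      (cont_ii (continuousOn_const.fun_mul ((hc _).fun_mul (hc _))) h1 h12)] at e
  simp only [intervalIntegral.integral_const_mul] at e
  have p1 := hp (N+1) t1 h1
  have p2 := (hC (N+1)).1 t2 ⟨h12, le_rfl⟩
  have j1 := i1 (N+1)
  have e1 : lam^N = (q^(3*N))^2 := by rw [hl, ← pow_mul, ← pow_mul]; congr 1; ring
  have e2 : q^(3*(N+1)) = q^(3*N) * q^3 := by rw [← pow_add]; congr 1
  have e3 : lam^(N+1) = (q^(3*N))^2 * (q^3)^2 := by rw [pow_succ, e1, hl]; ring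
  have hv : 1 ≤ q^(3*N) := one_le_pow₀ hq.le
  rw [e2] at j1
  rw [e1, e3] at e
  have hw : 0 < q^3 := by positivity
  generalize q^(3*N) = v at *
  generalize q^3 = w at *
  have hv0 : 0 < v := by linarith
  have hk : v * (v * ∫ t in t1..t2, (a t N)^2) ≤ v * (C + w * (C * C + (t2 - t1))) := by
    have := mul_le_mul_of_nonneg_left j1 (by positivity : 0 ≤ v * w)
    have h3 : C ≤ v * C := by nlinarith
    nlinarith
  exact le_of_mul_le_mul_left hk hv0

theorem dissipation (a : ℝ → ℕ → ℝ) (ha : IsDyadicSolution (lam ^ (-(1:ℝ)/3)) a)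
    (h0 : ∀ j, 0 ≤ a 0 j) (t1 t2 : ℝ) (h1 : 0 ≤ t1) (h12 : t1 ≤ t2) :
    IntervalIntegrable (fun t => ∑' j, (dvar a t j)^2) volume t1 t2 ∧
    ∑' j, (bvar a t2 j)^2 - ∑' j, (bvar a t1 j)^2
      ≤ -(2 - lam ^ ((3:ℝ)/8)) * ∫ t in t1..t2, ∑' j, (dvar a t j)^2 := by
  obtain ⟨q, hq1, hq2, hl, hf0, hhat, hm6, h6, hj3⟩ := exists_q
  have hq0 : 0 < q := by linarith
  have hlp : 0 < lam := by rw [hl]; positivity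
  rw [hf0] at ha
  have hf : 0 ≤ (q^2)⁻¹ := by positivity
  have hp := sol_pos ha hf hlp h0
  have hT : 0 ≤ t2 - t1 := by linarith
  have hc := sol_cont ha
  have hb : ∀ t j, bvar a t j = a t j - (q^(2*j))⁻¹ := fun t j => by rw [bvar, hhat]
  have hd0 : ∀ t, dvar a t 0 = q⁻¹ * bvar a t 0 := fun t => by simp only [dvar, hm6]
  have hd : ∀ t j, dvar a t (j+1) = q^(2*j) * (q * bvar a t (j+1) - q⁻¹ * bvar a t j) :=
    fun t j => by simp only [dvar, hm6, h6, hj3]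
  have hbc : ∀ j, ContinuousOn (fun t => bvar a t j) (Ici 0) := fun j =>
    (hc j).fun_sub continuousOn_const
  have hdc : ∀ j, ContinuousOn (fun t => dvar a t j) (Ici 0) := by
    intro j
    cases j with
    | zero => exact continuousOn_const.fun_mul (hbc 0)
    | succ j =>
      exact continuousOn_const.fun_mul
        ((continuousOn_const.fun_mul (hbc _)).fun_sub (continuousOn_const.fun_mul (hbc _)))
  have hdi : ∀ j, IntervalIntegrable (fun t => (dvar a t j)^2) volume t1 t2 := fun j =>
    cont_ii ((hdc j).fun_pow 2) h1 h12
  have hbs : ∀ t, 0 ≤ t → Summable (fun j => (bvar a t j)^2) := by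
    intro t ht
    have g : Summable (fun j : ℕ => (((q⁻¹)^4)^j)) :=
      summable_geometric_of_lt_one (by positivity)
        (pow_lt_one₀ (by positivity) (inv_lt_one_of_one_lt₀ hq1) (by norm_num))
    refine Summable.of_nonneg_of_le (fun j => sq_nonneg _) (fun j => ?_)
      (((ha.1 t ht).mul_left 2).add (g.mul_left 2))
    have : ((q⁻¹)^4)^j = ((q^(2*j))⁻¹)^2 := by
      rw [← inv_pow, ← pow_mul, ← pow_mul]; congr 1; ring
    rw [hb, this]
    nlinarith [sq_nonneg (a t j + (q^(2*j))⁻¹)]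
  let x : ℕ → ℝ := fun j => ∫ t in t1..t2, (dvar a t j)^2
  have hx0 : ∀ j, 0 ≤ x j := fun j =>
    intervalIntegral.integral_nonneg h12 (fun _ _ => sq_nonneg _)
  let S : ℕ → ℝ := fun N => ∑ j ∈ range (N+1), x j
  have hSs : ∀ N, S (N+1) = S N + x (N+1) := fun N => Finset.sum_range_succ _ _
  -- energy inequality for the truncated sums
  have key : ∀ N, ∑ j ∈ range (N+1), (bvar a t2 j)^2 - ∑ j ∈ range (N+1), (bvar a t1 j)^2
      ≤ S (N+1) - 2 * S N := by
    intro N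
    have c1 : ContinuousOn (fun t => ∑ j ∈ range (N+1), 2 * bvar a t j * dyadicRHS ((q^2)⁻¹) (a t) j)
        (Ici 0) := continuousOn_finsetSum _ (fun j _ =>
          (continuousOn_const.fun_mul (hbc j)).fun_mul (sol_rhs_cont ha j))
    have e := ftc_aux (fun t => ∑ j ∈ range (N+1), (bvar a t j)^2)
      (fun t => ∑ j ∈ range (N+1), 2 * bvar a t j * dyadicRHS ((q^2)⁻¹) (a t) j) t1 t2 h1 h12 (by
        intro y hy
        refine HasDerivWithinAt.congr_deriv (HasDerivWithinAt.fun_sum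
          (fun j _ => ((ha.2 j y hy).sub_const (lam ^ (-(j:ℝ)/3))).fun_pow 2)) ?_
        apply Finset.sum_congr rfl
        intros; simp [bvar]) c1
    rw [← e]
    have i1 : IntervalIntegrable (fun t => ∑ j ∈ range (N+1), (dvar a t j)^2) volume t1 t2 :=
      cont_ii (continuousOn_finsetSum _ (fun j _ => (hdc j).fun_pow 2)) h1 h12
    have e2 : ∫ t in t1..t2, ((dvar a t (N+1))^2 - ∑ j ∈ range (N+1), (dvar a t j)^2)
        = x (N+1) - S N := by
      rw [intervalIntegral.integral_sub (hdi _) i1,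
        intervalIntegral.integral_finset_sum (fun j _ => hdi j)]
    calc _ ≤ ∫ t in t1..t2, ((dvar a t (N+1))^2 - ∑ j ∈ range (N+1), (dvar a t j)^2) := by
          apply intervalIntegral.integral_mono_on h12 (cont_ii c1 h1 h12) ((hdi _).sub i1)
          intro y hy
          rw [rhs_identity q hq0.ne' hl (a y) (bvar a y) (dvar a y) (hb y) (hd0 y) (hd y) N]
          have p1 := hp (N+1) y (h1.trans hy.1)
          have : 0 ≤ 2 * (q^6)^N * (bvar a y N)^2 * a y (N+1) := by positivity
          have := sq_nonneg (q^(2*N) * q * bvar a y (N+1))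
          linarith
      _ = _ := by rw [e2, hSs]; ring
  -- growth of the truncated dissipation
  obtain ⟨C, hC0, hC⟩ := shell_bound ha hf q hq1 hl hp t1 t2 h1 h12
  have hxg : ∀ N, x (N+1) ≤ (8 * q^2 * C + 8 * (t2 - t1)) * q^N := by
    intro N
    have hq : 1 ≤ q^N := one_le_pow₀ hq1.le
    have s1 := cont_ii ((hc (N+1)).fun_pow 2) h1 h12
    have s0 := cont_ii ((hc N).fun_pow 2) h1 h12
    have m : x (N+1) ≤ ∫ t in t1..t2, (4 * (q^(2*N))^2 * q^2 * ((a t (N+1))^2 + (a t N)^2) + 8) := by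
      apply intervalIntegral.integral_mono_on h12 (hdi _)
        (((s1.add s0).const_mul _).add (by simp))
      intro y hy
      rw [hd, hb, hb]
      have f2 : q^(2*(N+1)) = q^(2*N) * q^2 := by rw [← pow_add]; congr 1
      rw [f2]
      have hu : 0 < q^(2*N) := by positivity
      generalize q^(2*N) = u at *
      have r : u * (q * (a y (N+1) - (u * q^2)⁻¹) - q⁻¹ * (a y N - u⁻¹))
        = u * q * a y (N+1) - u * q⁻¹ * a y N := by field_simp; ring
      rw [r]
      have hqi : q⁻¹^2 ≤ q^2 := by
        have : q⁻¹ ≤ q := (inv_le_one_of_one_le₀ hq1.le).trans hq1.le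
        gcongr
      have h3 : (u * a y N)^2 * q⁻¹^2 ≤ (u * a y N)^2 * q^2 :=
        mul_le_mul_of_nonneg_left hqi (sq_nonneg _)
      nlinarith [sq_nonneg (u * q * a y (N+1) + u * q⁻¹ * a y N), sq_nonneg (u * q * a y (N+1)), sq_nonneg (u * q * a y N)]
    rw [intervalIntegral.integral_add ((s1.add s0).const_mul _) (by simp),
      intervalIntegral.integral_const_mul, intervalIntegral.integral_add s1 s0,
      intervalIntegral.integral_const, smul_eq_mul] at m
    have y0 := hC N
    have y1 := hC (N+1)
    have n1 : 0 ≤ ∫ t in t1..t2, (a t (N+1))^2 :=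
      intervalIntegral.integral_nonneg h12 (fun _ _ => sq_nonneg _)
    have y1' : q^(3*N) * ∫ t in t1..t2, (a t (N+1))^2 ≤ C :=
      (mul_le_mul_of_nonneg_right (pow_le_pow_right₀ hq1.le (by omega)) n1).trans y1
    have e4 : (q^(2*N))^2 = q^N * q^(3*N) := by rw [← pow_mul, ← pow_add]; congr 1; ring
    rw [e4] at m
    have : q^N * q^2 * (q^(3*N) * (∫ t in t1..t2, (a t (N+1))^2) + q^(3*N) * ∫ t in t1..t2, (a t N)^2)
      ≤ q^N * q^2 * (C + C) := mul_le_mul_of_nonneg_left (add_le_add y1' y0) (by positivity)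
    have : (t2 - t1) ≤ (t2 - t1) * q^N := le_mul_of_one_le_right hT hq
    linarith
  set D := 8 * q^2 * C + 8 * (t2 - t1) with hD
  have hD0 : 0 ≤ D := by positivity
  have hq1' : 0 < q - 1 := by linarith
  set B := ∑' j, (bvar a t1 j)^2 with hB
  have hB0 : 0 ≤ B := tsum_nonneg (fun j => sq_nonneg _)
  have hSg : ∀ N, S N ≤ (x 0 + D / (q-1)) * q^N := by
    intro N
    induction N with
    | zero =>
      have : 0 ≤ D / (q-1) := by positivity
      simp [S]; linarith
    | succ N ih =>
      rw [hSs]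
      have h2 := hxg N
      have h3 : D = D / (q-1) * (q-1) := by field_simp
      have h4 : 0 ≤ x 0 * (q-1) * q^N := mul_nonneg (mul_nonneg (hx0 0) hq1'.le) (by positivity)
      have h5 : D * q^N = D / (q-1) * (q-1) * q^N := by rw [← h3]
      rw [pow_succ]
      nlinarith
  have hSB : ∀ N, S N ≤ B := by
    refine seq_bound S B (x 0 + D / (q-1)) q hq0 hq2 (fun N => ?_) (fun N => ?_)
    · have k := key N
      have : ∑ j ∈ range (N+1), (bvar a t1 j)^2 ≤ B :=
        (hbs t1 h1).sum_le_tsum _ (fun j _ => sq_nonneg _)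
      have : 0 ≤ ∑ j ∈ range (N+1), (bvar a t2 j)^2 := Finset.sum_nonneg (fun j _ => sq_nonneg _)
      linarith
    · linarith [hSg N]
  have hxs : Summable x := by
    refine summable_of_sum_range_le hx0 (c := B) (fun n => ?_)
    refine le_trans ?_ (hSB n)
    show _ ≤ ∑ j ∈ range (n+1), x j
    rw [Finset.sum_range_succ]
    linarith [hx0 n]
  have hxe : ∀ j, x j = ∫ t in Ioc t1 t2, (dvar a t j)^2 := fun j =>
    intervalIntegral.integral_of_le h12
  obtain ⟨I1, I2⟩ := integrable_tsum_aux (μ := volume.restrict (Ioc t1 t2))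
    (fun j t => (dvar a t j)^2) (fun j => (intervalIntegrable_iff_integrableOn_Ioc_of_le h12).1 (hdi j))
    (fun _ _ => sq_nonneg _) (by simpa only [← hxe] using hxs)
  refine ⟨(intervalIntegrable_iff_integrableOn_Ioc_of_le h12).2 I1, ?_⟩
  rw [intervalIntegral.integral_of_le h12]
  simp only [← hxe] at I2
  set J := ∫ t in Ioc t1 t2, ∑' j, (dvar a t j)^2 with hJ
  have hJ0 : 0 ≤ J := I2.nonneg hx0
  have tS : Tendsto S atTop (nhds J) := (tendsto_add_atTop_iff_nat 1).2 I2.tendsto_sum_nat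
  have tS1 : Tendsto (fun N => S (N+1)) atTop (nhds J) := (tendsto_add_atTop_iff_nat 1).2 tS
  have tb : ∀ t, 0 ≤ t → Tendsto (fun N => ∑ j ∈ range (N+1), (bvar a t j)^2) atTop
      (nhds (∑' j, (bvar a t j)^2)) := fun t ht =>
    (tendsto_add_atTop_iff_nat 1).2 (hbs t ht).hasSum.tendsto_sum_nat
  have lim := le_of_tendsto_of_tendsto' ((tb t2 (h1.trans h12)).sub (tb t1 h1))
    (tS1.sub (tS.const_mul 2)) key
  have hα := lam_coeff
  nlinarith
end

section
/- Exponential convergence to the fixed point: every solution a(t) of the dyadic system with a_j(0) ≥ 0 satisfies |a(t) − â|² ≤ |a(0) − â|² e^{−βt} for a universal constant β > 0, where â_j = λ^{−j/3} is the fixed point; one may take β = (2 − λ^{3/8}) / Σ_{j=0}^∞ λ^{1/3 − 2j/3}(j+1). -/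
open Real Set MeasureTheory Finset Filter

/-- FTC on `[0,∞)`. -/
lemma ftc_Ici {f f' : ℝ → ℝ} (hf : ∀ t ∈ Ici (0:ℝ), HasDerivWithinAt f (f' t) (Ici 0) t)
    (hc : ContinuousOn f' (Ici 0)) {T : ℝ} (hT : 0 ≤ T) : ∫ s in (0:ℝ)..T, f' s = f T - f 0 := by
  have hsub : Set.uIcc 0 T ⊆ Ici (0:ℝ) := by
    rw [Set.uIcc_of_le hT]; exact fun x hx => hx.1
  apply intervalIntegral.integral_eq_sub_of_hasDeriv_right
  · exact fun x hx => ((hf x (hsub hx)).continuousWithinAt).mono hsub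
  · intro x hx
    rw [min_eq_left hT] at hx
    exact (hf x hx.1.le).mono (fun y hy => (hx.1.trans hy).le)
  · exact (hc.mono hsub).intervalIntegrable

lemma ii_Ici {f : ℝ → ℝ} (hc : ContinuousOn f (Ici 0)) {T : ℝ} (hT : 0 ≤ T) :
    IntervalIntegrable f volume 0 T := by
  refine (hc.mono ?_).intervalIntegrable
  rw [Set.uIcc_of_le hT]; exact fun x hx => hx.1

lemma imono {f g : ℝ → ℝ} (hf : ContinuousOn f (Ici 0)) (hg : ContinuousOn g (Ici 0))
    {T : ℝ} (hT : 0 ≤ T) (h : ∀ t ∈ Icc 0 T, f t ≤ g t) :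
    ∫ s in (0:ℝ)..T, f s ≤ ∫ s in (0:ℝ)..T, g s :=
  intervalIntegral.integral_mono_on hT (ii_Ici hf hT) (ii_Ici hg hT) h

/-- Positivity for linear equations with nonnegative source. -/
lemma pos_linear {f g h : ℝ → ℝ}
    (hf : ∀ t ∈ Ici (0:ℝ), HasDerivWithinAt f (g t - h t * f t) (Ici 0) t)
    (hh : ContinuousOn h (Ici 0)) (hg : ∀ t ∈ Ici (0:ℝ), 0 ≤ g t) (h0 : 0 ≤ f 0) :
    ∀ t ∈ Ici (0:ℝ), 0 ≤ f t := by
  set k : ℝ → ℝ := fun s => h (max s 0) with hk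
  have hkc : Continuous k :=
    hh.comp_continuous (by fun_prop) (fun x => le_max_right x 0)
  set H : ℝ → ℝ := fun t => ∫ s in (0:ℝ)..t, k s with hH
  have hHd : ∀ t, HasDerivAt H (k t) t := fun t =>
    intervalIntegral.integral_hasDerivAt_right (hkc.intervalIntegrable _ _)
      (hkc.stronglyMeasurableAtFilter _ _) hkc.continuousAt
  have hd : ∀ t ∈ Ici (0:ℝ), HasDerivWithinAt (fun s => Real.exp (H s) * f s)
      (Real.exp (H t) * g t) (Ici 0) t := by
    intro t ht
    have h1 := ((hHd t).exp.hasDerivWithinAt (s := Ici 0)).mul (hf t ht)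
    refine h1.congr_deriv ?_
    have : k t = h t := by simp only [hk]; rw [max_eq_left ht]
    rw [this]; ring
  have hmono : MonotoneOn (fun s => Real.exp (H s) * f s) (Ici 0) := by
    apply monotoneOn_of_hasDerivWithinAt_nonneg (f' := fun t => Real.exp (H t) * g t) (convex_Ici 0)
    · exact fun x hx => (hd x hx).continuousWithinAt
    · intro x hx
      rw [interior_Ici] at hx ⊢
      exact (hd x (mem_Ici.2 (le_of_lt (mem_Ioi.1 hx)))).mono Ioi_subset_Ici_self
    · intro x hx
      rw [interior_Ici] at hx
      exact mul_nonneg (Real.exp_pos _).le (hg x (mem_Ici.2 (le_of_lt (mem_Ioi.1 hx))))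
  intro t ht
  have h2 := hmono (self_mem_Ici) ht ht
  have h3 : 0 ≤ Real.exp (H 0) * f 0 := mul_nonneg (Real.exp_pos _).le h0
  exact nonneg_of_mul_nonneg_right (h3.trans h2) (Real.exp_pos _)

lemma growth {κ C C' : ℝ} (hκ : 1 < κ) (hκ2 : κ < 2) {E : ℕ → ℝ} (hE : ∀ n, E n ≤ C * κ ^ n)
    (hF : ∀ n, ∑ i ∈ Finset.range n, E i ≤ C' + E n) (n : ℕ) :
    ∑ i ∈ Finset.range n, E i ≤ C' := by
  by_contra! hcon
  set G : ℕ → ℝ := fun n => ∑ i ∈ Finset.range n, E i - C' with hG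
  have hGn : 0 < G n := by simp only [hG]; linarith
  have hstep : ∀ m, 2 * G m ≤ G (m+1) := by
    intro m
    have := hF m
    simp only [hG, Finset.sum_range_succ]; linarith
  have hpow : ∀ k, 2 ^ k * G n ≤ G (n + k) := by
    intro k
    induction k with
    | zero => simp
    | succ k ih =>
      have := hstep (n+k)
      rw [pow_succ, ← add_assoc]; linarith
  have hle : ∀ k, G n ≤ C * κ ^ n * (κ/2) ^ k := by
    intro k
    have h1 := hpow k
    have h2 := hF (n+k)
    have h3 := hE (n+k)
    have h4 : 2 ^ k * G n ≤ C * κ ^ (n+k) := by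
      have : G (n+k) ≤ E (n+k) := by simp only [hG]; linarith
      linarith
    rw [div_pow, mul_div_assoc', le_div_iff₀ (by positivity)]
    calc _ = 2 ^ k * G n := by ring
      _ ≤ _ := h4
      _ = _ := by ring
  have ht : Tendsto (fun k => C * κ ^ n * (κ/2) ^ k) atTop (nhds (C * κ ^ n * 0)) :=
    (tendsto_pow_atTop_nhds_zero_of_lt_one (by linarith) (by linarith)).const_mul _
  have := ge_of_tendsto' ht hle
  simp at this
  linarith

lemma core {κ : ℝ} (hκ : 1 < κ) (hκ2 : κ < 2) (A : ℝ → ℕ → ℝ)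
    (hA0 : ∀ t ∈ Ici (0:ℝ), HasDerivWithinAt (fun s => A s 0) (κ⁻¹ * (1 - A t 0 * A t 1)) (Ici 0) t)
    (hAs : ∀ j, ∀ t ∈ Ici (0:ℝ), HasDerivWithinAt (fun s => A s (j+1))
      (κ ^ (2*j+1) * ((A t j)^2 - A t (j+1) * A t (j+2))) (Ici 0) t)
    (hinit : ∀ j, 0 ≤ A 0 j) {C0 C1 K : ℝ}
    (hC0 : ∀ n, ∑ j ∈ Finset.range (n+1), ((κ^j)⁻¹)^2 * (A 0 j - 1)^2 ≤ C0)
    (hC1 : ∀ n, ∑ j ∈ Finset.range (n+1), ((κ^j)⁻¹)^2 * (A 0 j)^2 ≤ C1)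
    (hKpos : 0 < K)
    (hK : ∀ n, κ * ∑ j ∈ Finset.range (n+1), ((κ^j)⁻¹)^2 * ((j:ℝ)+1) ≤ K)
    {T : ℝ} (hT : 0 ≤ T) (n : ℕ) :
    ∑ j ∈ Finset.range (n+1), ((κ^j)⁻¹)^2 * (A T j - 1)^2 ≤ C0 * Real.exp (-T/K) := by
  have hk0 : 0 < κ := by linarith
  have hcont : ∀ j, ContinuousOn (fun s => A s j) (Ici 0) := by
    intro j
    cases j with
    | zero => exact fun x hx => (hA0 x hx).continuousWithinAt
    | succ j => exact fun x hx => (hAs j x hx).continuousWithinAt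
  have hpos : ∀ j, ∀ t ∈ Ici (0:ℝ), 0 ≤ A t j := by
    intro j
    cases j with
    | zero =>
      apply pos_linear (g := fun _ => κ⁻¹) (h := fun t => κ⁻¹ * A t 1)
      · intro t ht
        refine (hA0 t ht).congr_deriv ?_
        ring
      · exact continuousOn_const.mul (hcont 1)
      · intro t ht; positivity
      · exact hinit 0
    | succ j =>
      apply pos_linear (g := fun t => κ^(2*j+1) * (A t j)^2) (h := fun t => κ^(2*j+1) * A t (j+2))
      · intro t ht
        refine (hAs j t ht).congr_deriv ?_
        ring
      · exact continuousOn_const.mul (hcont _)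
      · intro t ht; positivity
      · exact hinit _
  -- energy
  have hw : ∀ j : ℕ, ((κ^(j+1))⁻¹)^2 * κ^(2*j+1) = κ⁻¹ := by
    intro j
    field_simp
    ring
  have hen : ∀ n, ∀ t ∈ Ici (0:ℝ), HasDerivWithinAt
      (fun s => ∑ j ∈ Finset.range (n+1), ((κ^j)⁻¹)^2 * (A s j)^2)
      (2 * κ⁻¹ * (A t 0 - (A t n)^2 * A t (n+1))) (Ici 0) t := by
    intro n t ht
    induction n with
    | zero =>
      simp only [zero_add, Finset.sum_range_one]
      refine (((hA0 t ht).pow 2).const_mul (((κ^0)⁻¹)^2)).congr_deriv ?_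
      simp; ring
    | succ n ih =>
      simp only [Finset.sum_range_succ _ (n+1)]
      refine (ih.add (((hAs n t ht).pow 2).const_mul (((κ^(n+1))⁻¹)^2))).congr_deriv ?_
      have := hw n
      simp only [Nat.cast_ofNat, Nat.add_one_sub_one, pow_one]
      linear_combination (2 * A t (n+1) * ((A t n)^2 - A t (n+1) * A t (n+2))) * this
  have hdev : ∀ n, ∀ t ∈ Ici (0:ℝ), HasDerivWithinAt
      (fun s => ∑ j ∈ Finset.range (n+1), ((κ^j)⁻¹)^2 * (A s j - 1)^2)
      (κ⁻¹ * (-((A t 0 - 1)^2 + ∑ i ∈ Finset.range n, (A t (i+1) - A t i)^2)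
        + (-2 * (A t n)^2 * A t (n+1) + (A t n)^2 + 2 * A t n * A t (n+1) - 1))) (Ici 0) t := by
    intro n t ht
    induction n with
    | zero =>
      simp only [zero_add, Finset.sum_range_one]
      refine ((((hA0 t ht).sub_const 1).pow 2).const_mul (((κ^0)⁻¹)^2)).congr_deriv ?_
      simp; ring
    | succ n ih =>
      simp only [Finset.sum_range_succ _ (n+1)]
      refine (ih.add ((((hAs n t ht).sub_const 1).pow 2).const_mul (((κ^(n+1))⁻¹)^2))).congr_deriv ?_
      have := hw n
      simp only [Nat.cast_ofNat, Nat.add_one_sub_one, pow_one, Finset.sum_range_succ _ n]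
      linear_combination (2 * (A t (n+1) - 1) * ((A t n)^2 - A t (n+1) * A t (n+2))) * this
  -- energy bound
  obtain ⟨M0, hM0⟩ := (isCompact_Icc (a := (0:ℝ)) (b := T)).exists_bound_of_continuousOn
    ((hcont 0).mono (fun x hx => hx.1))
  have hM0' : ∀ t ∈ Icc 0 T, A t 0 ≤ M0 := fun t ht => (le_abs_self _).trans (hM0 t ht)
  have hM0nn : 0 ≤ M0 := (norm_nonneg _).trans (hM0 0 ⟨le_refl _, hT⟩)
  have hC1nn : 0 ≤ C1 := (Finset.sum_nonneg (fun i _ => by positivity)).trans (hC1 0)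
  have hC0nn : 0 ≤ C0 := (Finset.sum_nonneg (fun i _ => by positivity)).trans (hC0 0)
  have hflux_c : ∀ n, ContinuousOn (fun s => (A s n)^2 * A s (n+1)) (Ici 0) :=
    fun n => ((hcont n).pow 2).mul (hcont (n+1))
  have hflux : ∀ n, ∀ t ∈ Icc 0 T, ∑ j ∈ Finset.range (n+1), ((κ^j)⁻¹)^2 * (A t j)^2
      + 2 * κ⁻¹ * ∫ s in (0:ℝ)..t, (A s n)^2 * A s (n+1) ≤ C1 + 2 * κ⁻¹ * M0 * T := by
    intro n t ht
    have h1 := ftc_Ici (hen n) (continuousOn_const.mul ((hcont 0).sub (hflux_c n))) ht.1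
    rw [intervalIntegral.integral_const_mul, intervalIntegral.integral_sub (ii_Ici (hcont 0) ht.1)
      (ii_Ici (hflux_c n) ht.1)] at h1
    have h2 : ∫ s in (0:ℝ)..t, A s 0 ≤ ∫ s in (0:ℝ)..t, M0 :=
      imono (hcont 0) continuousOn_const ht.1 (fun s hs => hM0' s ⟨hs.1, hs.2.trans ht.2⟩)
    rw [intervalIntegral.integral_const, smul_eq_mul, sub_zero] at h2
    have h3 : t * M0 ≤ T * M0 := mul_le_mul_of_nonneg_right ht.2 hM0nn
    have h4 := hC1 n
    have h5 : 2 * κ⁻¹ * ∫ s in (0:ℝ)..t, A s 0 ≤ 2 * κ⁻¹ * (T * M0) :=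
      mul_le_mul_of_nonneg_left (h2.trans h3) (by positivity)
    linarith
  set M := C1 + 2 * κ⁻¹ * M0 * T with hM
  have hMnn : 0 ≤ M := by positivity
  have hAle : ∀ n, ∀ t ∈ Icc 0 T, A t n ≤ κ ^ n * (M + 1) := by
    intro n t ht
    have h1 := hflux n t ht
    have h2 : 0 ≤ ∫ s in (0:ℝ)..t, (A s n)^2 * A s (n+1) :=
      intervalIntegral.integral_nonneg ht.1 (fun u hu => mul_nonneg (sq_nonneg _) (hpos _ _ hu.1))
    have h3 : ((κ^n)⁻¹)^2 * (A t n)^2 ≤ ∑ j ∈ Finset.range (n+1), ((κ^j)⁻¹)^2 * (A t j)^2 :=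
      Finset.single_le_sum (f := fun j => ((κ^j)⁻¹)^2 * (A t j)^2)
        (fun i _ => by positivity) (by simp)
    have h4 : 0 ≤ 2 * κ⁻¹ * ∫ s in (0:ℝ)..t, (A s n)^2 * A s (n+1) := by positivity
    have h5 : ((κ^n)⁻¹ * A t n)^2 ≤ (M+1)^2 := by
      rw [mul_pow]; nlinarith
    have h6 := abs_le_of_sq_le_sq' h5 (by positivity)
    have h7 := h6.2
    rwa [inv_mul_le_iff₀ (by positivity)] at h7
  have hIflux : ∀ n, ∫ s in (0:ℝ)..T, (A s n)^2 * A s (n+1) ≤ κ * M := by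
    intro n
    have h1 := hflux n T ⟨hT, le_refl _⟩
    have h3 : 0 ≤ ∑ j ∈ Finset.range (n+1), ((κ^j)⁻¹)^2 * (A T j)^2 :=
      Finset.sum_nonneg (fun i _ => by positivity)
    have h2 : 0 ≤ ∫ s in (0:ℝ)..T, (A s n)^2 * A s (n+1) :=
      intervalIntegral.integral_nonneg hT (fun u hu => mul_nonneg (sq_nonneg _) (hpos _ _ hu.1))
    have h4 : κ⁻¹ * ∫ s in (0:ℝ)..T, (A s n)^2 * A s (n+1) ≤ M := by
      have : 0 ≤ κ⁻¹ * ∫ s in (0:ℝ)..T, (A s n)^2 * A s (n+1) := by positivity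
      linarith
    rwa [inv_mul_le_iff₀ hk0] at h4
  have hk1 : ∀ n : ℕ, 1 ≤ κ ^ n := fun n => one_le_pow₀ hκ.le
  have hsqc : ∀ n, ContinuousOn (fun s => (A s n)^2) (Ici 0) := fun n => (hcont n).pow 2
  have hprc : ∀ n, ContinuousOn (fun s => A s (n+1) * A s (n+2)) (Ici 0) :=
    fun n => (hcont (n+1)).mul (hcont (n+2))
  obtain ⟨C, hCnn, hsq⟩ : ∃ C, 0 ≤ C ∧ ∀ n, ∫ s in (0:ℝ)..T, (A s n)^2 ≤ C * κ ^ n := by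
    refine ⟨(M+1) + κ * M + T * (κ^2 * (M+1)), by positivity, fun n => ?_⟩
    have h1 := ftc_Ici (hAs n) (continuousOn_const.mul ((hsqc n).sub (hprc n))) hT
    rw [intervalIntegral.integral_const_mul, intervalIntegral.integral_sub
      (ii_Ici (hsqc n) hT) (ii_Ici (hprc n) hT)] at h1
    have h2 : ∫ s in (0:ℝ)..T, A s (n+1) * A s (n+2) ≤
        ∫ s in (0:ℝ)..T, ((A s (n+1))^2 * A s (n+2) + κ^(n+2) * (M+1)) := by
      apply imono ((hcont (n+1)).mul (hcont (n+2))) ((hflux_c (n+1)).add continuousOn_const) hT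
      intro t ht
      have a1 := hAle (n+2) t ht
      have a2 := hpos (n+2) t ht.1
      show A t (n+1) * A t (n+2) ≤ (A t (n+1))^2 * A t (n+2) + κ^(n+2) * (M+1)
      nlinarith [sq_nonneg (A t (n+1) - 1), mul_nonneg a2 (sq_nonneg (A t (n+1) - 1)),
        mul_nonneg a2 (sq_nonneg (A t (n+1)))]
    rw [intervalIntegral.integral_add (ii_Ici (hflux_c (n+1)) hT) (by simp),
      intervalIntegral.integral_const, smul_eq_mul, sub_zero] at h2
    have h3 := hIflux (n+1)
    have h4 := hinit (n+1)
    have h5 := hAle (n+1) T ⟨hT, le_refl _⟩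
    have h6 : κ ^ (2*n+1) * (∫ s in (0:ℝ)..T, (A s n)^2) ≤
       κ^(2*n+1) * ((M+1) + ∫ s in (0:ℝ)..T, A s (n+1) * A s (n+2)) := by
      have : κ^(n+1) * (M+1) ≤ κ^(2*n+1) * (M+1) :=
        mul_le_mul_of_nonneg_right (pow_le_pow_right₀ hκ.le (by omega)) (by positivity)
      linarith
    have h7 := le_of_mul_le_mul_left h6 (by positivity)
    have h8 : (M+1) + κ * M ≤ ((M+1) + κ * M) * κ^n :=
      le_mul_of_one_le_right (by positivity) (hk1 n)
    have h9 : T * (κ^(n+2) * (M+1)) = T * (κ^2 * (M+1)) * κ^n := by ring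
    have h10 : (∫ s in (0:ℝ)..T, A s (n+1) ^ 2 * A s (n+1+1)) = ∫ s in (0:ℝ)..T, A s (n+1) ^ 2 * A s (n+2) := rfl
    linarith
  have hDc : ∀ n, ContinuousOn (fun s => (A s (n+1) - A s n)^2) (Ici 0) :=
    fun n => ((hcont (n+1)).sub (hcont n)).pow 2
  set E : ℕ → ℝ := fun n => ∫ s in (0:ℝ)..T, (A s (n+1) - A s n)^2 with hE
  have hEnn : ∀ n, 0 ≤ E n := fun n =>
    intervalIntegral.integral_nonneg hT (fun u _ => sq_nonneg _)
  have hEle : ∀ n, E n ≤ (C * κ + C) * κ ^ n := by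
    intro n
    have h1 : E n ≤ ∫ s in (0:ℝ)..T, ((A s (n+1))^2 + (A s n)^2) := by
      refine imono (hDc n) ((hsqc (n+1)).add (hsqc n)) hT ?_
      intro t ht
      have a1 := hpos (n+1) t ht.1
      have a2 := hpos n t ht.1
      show (A t (n+1) - A t n)^2 ≤ (A t (n+1))^2 + (A t n)^2
      nlinarith [mul_nonneg a1 a2]
    rw [intervalIntegral.integral_add (ii_Ici (hsqc (n+1)) hT) (ii_Ici (hsqc n) hT)] at h1
    have h2 := hsq n
    have h3 := hsq (n+1)
    calc _ ≤ _ := h1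
      _ ≤ C * κ^(n+1) + C * κ^n := add_le_add h3 h2
      _ = _ := by ring
  -- boundary term
  have hbd : ∀ n, ∀ t ∈ Ici (0:ℝ), -2 * (A t n)^2 * A t (n+1) + (A t n)^2 + 2 * A t n * A t (n+1) - 1
      ≤ (A t (n+1) - A t n)^2 := by
    intro n t ht
    nlinarith [mul_nonneg (hpos (n+1) t ht) (sq_nonneg (A t n - 1)), sq_nonneg (A t (n+1) - 1)]
  have hXc : ∀ n, ContinuousOn (fun t => ∑ i ∈ Finset.range n, (A t (i+1) - A t i)^2) (Ici 0) :=
    fun n => continuousOn_finsetSum _ (fun i _ => hDc i)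
  have hPc : ∀ n, ContinuousOn (fun t => (κ⁻¹ * (-((A t 0 - 1)^2 + ∑ i ∈ Finset.range n, (A t (i+1) - A t i)^2)
        + (-2 * (A t n)^2 * A t (n+1) + (A t n)^2 + 2 * A t n * A t (n+1) - 1)))) (Ici 0) := by
    intro n
    have c0 := hcont 0
    have cn := hcont n
    have cn1 := hcont (n+1)
    have := hXc n
    fun_prop
  have hF : ∀ n, ∑ i ∈ Finset.range n, E i ≤ κ * C0 + E n := by
    intro n
    have h1 := ftc_Ici (hdev n) (hPc n) hT
    have h2 := imono (hPc n) (g := fun t => κ⁻¹ * ((A t (n+1) - A t n)^2 - ∑ i ∈ Finset.range n, (A t (i+1) - A t i)^2))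
      (continuousOn_const.mul ((hDc n).sub (hXc n))) hT (by
        intro t ht
        have := hbd n t ht.1
        apply mul_le_mul_of_nonneg_left _ (by positivity)
        nlinarith [sq_nonneg (A t 0 - 1)])
    rw [h1, intervalIntegral.integral_const_mul, intervalIntegral.integral_sub (ii_Ici (hDc n) hT)
      (ii_Ici (hXc n) hT), intervalIntegral.integral_finsetSum (fun i _ => ii_Ici (hDc i) hT)] at h2
    have h3 := hC0 n
    have h4 : 0 ≤ ∑ j ∈ Finset.range (n+1), ((κ^j)⁻¹)^2 * (A T j - 1)^2 :=
      Finset.sum_nonneg (fun i _ => by positivity)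
    have h5 : κ⁻¹ * (∑ i ∈ Finset.range n, E i - E n) ≤ C0 := by
      simp only [hE]; linarith
    rw [inv_mul_le_iff₀ hk0] at h5
    linarith
  have hFb := growth hκ hκ2 hEle hF
  have hE0 : Tendsto E atTop (nhds 0) :=
    (summable_of_sum_range_le hEnn hFb).tendsto_atTop_zero
  -- comparison
  have hcmp : ∀ t n, κ * ∑ j ∈ Finset.range (n+1), ((κ^j)⁻¹)^2 * (A t j - 1)^2 ≤
      K * ((A t 0 - 1)^2 + ∑ i ∈ Finset.range n, (A t (i+1) - A t i)^2) := by
    intro t n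
    set X : ℕ → ℝ := fun n => (A t 0 - 1)^2 + ∑ i ∈ Finset.range n, (A t (i+1) - A t i)^2 with hX
    have hXm : Monotone X := by
      apply monotone_nat_of_le_succ
      intro m
      simp only [hX, Finset.sum_range_succ]
      nlinarith [sq_nonneg (A t (m+1) - A t m)]
    have hXnn : ∀ m, 0 ≤ X m := fun m => by
      simp only [hX]
      have := Finset.sum_nonneg (s := Finset.range m) (fun i _ => sq_nonneg (A t (i+1) - A t i))
      positivity
    have hB : ∀ m : ℕ, (A t m - 1)^2 ≤ ((m:ℝ)+1) * X m := by
      intro m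
      induction m with
      | zero => simp [hX]
      | succ m ih =>
        have hs : X (m+1) = X m + (A t (m+1) - A t m)^2 := by
          simp only [hX, Finset.sum_range_succ]; ring
        rw [hs]
        push_cast
        -- (u+v)^2 ≤ (m+2)(X+v^2), u^2 ≤ (m+1) X
        set u := A t m - 1
        set v := A t (m+1) - A t m
        have e : A t (m+1) - 1 = u + v := by simp only [u, v]; ring
        rw [e]
        have hm : (0:ℝ) < (m:ℝ) + 1 := by positivity
        have h1 : 2*u*v ≤ u^2/((m:ℝ)+1) + ((m:ℝ)+1)*v^2 := by
          rw [← sub_nonneg]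
          have : u^2/((m:ℝ)+1) + ((m:ℝ)+1)*v^2 - 2*u*v = (u - ((m:ℝ)+1)*v)^2/((m:ℝ)+1) := by
            field_simp; ring
          rw [this]; positivity
        have h2 : u^2/((m:ℝ)+1) ≤ X m := by
          rw [div_le_iff₀ hm]; linarith
        nlinarith
    have h1 : ∑ j ∈ Finset.range (n+1), ((κ^j)⁻¹)^2 * (A t j - 1)^2 ≤
        (∑ j ∈ Finset.range (n+1), ((κ^j)⁻¹)^2 * ((j:ℝ)+1)) * X n := by
      rw [Finset.sum_mul]
      apply Finset.sum_le_sum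
      intro j hj
      have hjn : j ≤ n := by simpa [Nat.lt_succ_iff] using hj
      rw [mul_assoc]
      apply mul_le_mul_of_nonneg_left _ (by positivity)
      exact (hB j).trans (mul_le_mul_of_nonneg_left (hXm hjn) (by positivity))
    calc _ ≤ κ * ((∑ j ∈ Finset.range (n+1), ((κ^j)⁻¹)^2 * ((j:ℝ)+1)) * X n) :=
          mul_le_mul_of_nonneg_left h1 hk0.le
      _ = (κ * ∑ j ∈ Finset.range (n+1), ((κ^j)⁻¹)^2 * ((j:ℝ)+1)) * X n := by ring
      _ ≤ K * X n := mul_le_mul_of_nonneg_right (hK n) (hXnn n)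
  -- Gronwall
  have hgr : ∀ n, Real.exp (T/K) * ∑ j ∈ Finset.range (n+1), ((κ^j)⁻¹)^2 * (A T j - 1)^2 ≤
      C0 + κ⁻¹ * Real.exp (T/K) * E n := by
    intro n
    have hexpd : ∀ t : ℝ, HasDerivAt (fun s : ℝ => Real.exp (s/K)) (Real.exp (t/K) * (1/K)) t :=
      fun t => ((hasDerivAt_id t).div_const K).exp
    have hexpc : ContinuousOn (fun s : ℝ => Real.exp (s/K)) (Ici 0) := by fun_prop
    have hSc : ContinuousOn (fun s => ∑ j ∈ Finset.range (n+1), ((κ^j)⁻¹)^2 * (A s j - 1)^2) (Ici 0) :=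
      fun x hx => (hdev n x hx).continuousWithinAt
    have hdc : ContinuousOn (fun t => Real.exp (t/K) * (1/K) *
        (∑ j ∈ Finset.range (n+1), ((κ^j)⁻¹)^2 * (A t j - 1)^2) + Real.exp (t/K) *
        (κ⁻¹ * (-((A t 0 - 1)^2 + ∑ i ∈ Finset.range n, (A t (i+1) - A t i)^2)
        + (-2 * (A t n)^2 * A t (n+1) + (A t n)^2 + 2 * A t n * A t (n+1) - 1)))) (Ici 0) :=
      ((hexpc.mul continuousOn_const).mul hSc).add (hexpc.mul (hPc n))
    have h1 := ftc_Ici (fun t ht => ((hexpd t).hasDerivWithinAt (s := Ici 0)).mul (hdev n t ht)) hdc hT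
    have h2 := imono hdc (g := fun t => κ⁻¹ * Real.exp (T/K) * (A t (n+1) - A t n)^2)
      (continuousOn_const.mul (hDc n)) hT (by
        intro t ht
        have hb := hbd n t ht.1
        have hc := hcmp t n
        set S := ∑ j ∈ Finset.range (n+1), ((κ^j)⁻¹)^2 * (A t j - 1)^2
        set X := (A t 0 - 1)^2 + ∑ i ∈ Finset.range n, (A t (i+1) - A t i)^2
        set P := -2 * (A t n)^2 * A t (n+1) + (A t n)^2 + 2 * A t n * A t (n+1) - 1
        have e1 : 1/K * S ≤ κ⁻¹ * X := by
          rw [one_div, inv_mul_le_iff₀ hKpos, ← mul_assoc, mul_comm K, mul_assoc, le_inv_mul_iff₀ hk0]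
          exact hc
        have e2 : 1/K * S + κ⁻¹ * (-X + P) ≤ κ⁻¹ * (A t (n+1) - A t n)^2 := by
          have := mul_le_mul_of_nonneg_left hb (inv_nonneg.2 hk0.le)
          linarith
        have e3 : Real.exp (t/K) ≤ Real.exp (T/K) :=
          Real.exp_le_exp.2 (div_le_div_of_nonneg_right ht.2 hKpos.le)
        calc _ = Real.exp (t/K) * (1/K * S + κ⁻¹ * (-X + P)) := by ring
          _ ≤ Real.exp (t/K) * (κ⁻¹ * (A t (n+1) - A t n)^2) :=
            mul_le_mul_of_nonneg_left e2 (Real.exp_pos _).le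
          _ ≤ Real.exp (T/K) * (κ⁻¹ * (A t (n+1) - A t n)^2) :=
            mul_le_mul_of_nonneg_right e3 (by positivity)
          _ = _ := by ring)
    have h3 := h1.symm.trans_le h2
    rw [intervalIntegral.integral_const_mul] at h3
    simp only [Pi.mul_apply, zero_div, Real.exp_zero, one_mul] at h3
    have h4 := hC0 n
    simp only [hE]
    linarith
  have hSm : ∀ m, n ≤ m → Real.exp (T/K) * ∑ j ∈ Finset.range (n+1), ((κ^j)⁻¹)^2 * (A T j - 1)^2 ≤
      C0 + κ⁻¹ * Real.exp (T/K) * E m := by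
    intro m hm
    refine le_trans (mul_le_mul_of_nonneg_left ?_ (Real.exp_pos _).le) (hgr m)
    exact Finset.sum_le_sum_of_subset_of_nonneg
      (Finset.range_mono (by omega)) (fun i _ _ => by positivity)
  have hlim : Tendsto (fun m => C0 + κ⁻¹ * Real.exp (T/K) * E m) atTop
      (nhds (C0 + κ⁻¹ * Real.exp (T/K) * 0)) := (hE0.const_mul _).const_add _
  have hfin := ge_of_tendsto hlim (eventually_atTop.2 ⟨n, hSm⟩)
  rw [mul_zero, add_zero] at hfin
  rw [neg_div, Real.exp_neg, ← div_eq_mul_inv, le_div_iff₀ (Real.exp_pos _)]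
  linarith

theorem exponential_convergence (a : ℝ → ℕ → ℝ) (ha : IsDyadicSolution (lam ^ (-(1:ℝ)/3)) a)
    (h0 : ∀ j, 0 ≤ a 0 j) :
    0 < (2 - lam ^ ((3:ℝ)/8)) / ∑' j : ℕ, lam ^ ((1:ℝ)/3 - 2*(j:ℝ)/3) * ((j:ℝ)+1) ∧
    ∀ t ∈ Ici (0:ℝ),
      ∑' j, (bvar a t j)^2 ≤ (∑' j, (bvar a 0 j)^2) *
        Real.exp (-((2 - lam ^ ((3:ℝ)/8)) / ∑' j : ℕ, lam ^ ((1:ℝ)/3 - 2*(j:ℝ)/3) * ((j:ℝ)+1)) * t) := by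
  have hlam : 0 < lam := by unfold lam; positivity
  set κ : ℝ := lam ^ ((1:ℝ)/3) with hκdef
  have hκ' : κ = (2:ℝ) ^ ((5:ℝ)/6) := by
    rw [hκdef, lam, ← Real.rpow_mul (by norm_num)]; norm_num
  have hκ1 : 1 < κ := by
    rw [hκ']; exact Real.one_lt_rpow (by norm_num) (by norm_num)
  have hκ2 : κ < 2 := by
    rw [hκ']
    calc (2:ℝ) ^ ((5:ℝ)/6) < (2:ℝ) ^ (1:ℝ) :=
          Real.rpow_lt_rpow_of_exponent_lt (by norm_num) (by norm_num)
      _ = 2 := by norm_num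
  have hk0 : 0 < κ := by linarith
  have hlk : lam = κ ^ 3 := by
    rw [hκdef, ← Real.rpow_natCast, ← Real.rpow_mul hlam.le]; norm_num
  have hfix : ∀ j : ℕ, lam ^ (-(j:ℝ)/3) = (κ ^ j)⁻¹ := by
    intro j
    rw [hκdef, ← Real.rpow_natCast, ← Real.rpow_mul hlam.le, ← Real.rpow_neg hlam.le]
    congr 1; ring
  have hf0 : lam ^ (-(1:ℝ)/3) = κ⁻¹ := by
    have := hfix 1
    simpa using this
  have hwt : ∀ j : ℕ, lam ^ ((1:ℝ)/3 - 2*(j:ℝ)/3) = κ * ((κ^j)⁻¹)^2 := by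
    intro j
    rw [← hfix, pow_two, hκdef, ← Real.rpow_add hlam, ← Real.rpow_add hlam]
    congr 1; ring
  have hα1 : 1 ≤ lam ^ ((3:ℝ)/8) := by
    apply Real.one_le_rpow _ (by norm_num)
    rw [hlk]; exact one_le_pow₀ hκ1.le
  have hα2 : lam ^ ((3:ℝ)/8) < 2 := by
    rw [lam, ← Real.rpow_mul (by norm_num)]
    calc (2:ℝ) ^ ((5:ℝ)/2 * (3/8)) < (2:ℝ) ^ (1:ℝ) :=
          Real.rpow_lt_rpow_of_exponent_lt (by norm_num) (by norm_num)
      _ = 2 := by norm_num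
  simp only [hwt]
  have hr1 : (κ⁻¹)^2 < 1 := by
    rw [inv_pow]; exact inv_lt_one_of_one_lt₀ (one_lt_pow₀ hκ1 (by norm_num))
  have hr0 : 0 ≤ (κ⁻¹)^2 := by positivity
  have hweq : ∀ j : ℕ, ((κ^j)⁻¹)^2 = ((κ⁻¹)^2)^j := by
    intro j; rw [← inv_pow, ← pow_mul, ← pow_mul, mul_comm]
  have hgeo : Summable (fun j : ℕ => ((κ^j)⁻¹)^2) := by
    simp only [hweq]; exact summable_geometric_of_lt_one hr0 hr1
  have hgeo1 : Summable (fun j : ℕ => (j:ℝ) * ((κ^j)⁻¹)^2) := by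
    simp only [hweq]
    have := summable_pow_mul_geometric_of_norm_lt_one (R := ℝ) 1 (r := (κ⁻¹)^2)
      (by rw [Real.norm_of_nonneg hr0]; exact hr1)
    simpa using this
  have hKs : Summable (fun j : ℕ => κ * ((κ^j)⁻¹)^2 * ((j:ℝ)+1)) := by
    have := (hgeo1.add hgeo).mul_left κ
    refine this.congr (fun j => ?_)
    ring
  set K := ∑' j : ℕ, κ * ((κ^j)⁻¹)^2 * ((j:ℝ)+1) with hKdef
  have hKle : ∀ n, κ * ∑ j ∈ Finset.range (n+1), ((κ^j)⁻¹)^2 * ((j:ℝ)+1) ≤ K := by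
    intro n
    rw [Finset.mul_sum]
    simp only [← mul_assoc]
    exact hKs.sum_le_tsum _ (fun i _ => by positivity)
  have hKpos : 0 < K := by
    have := hKle 0
    simp at this
    linarith
  refine ⟨div_pos (by linarith) hKpos, fun t ht => ?_⟩
  obtain ⟨hsum, hode⟩ := ha
  have hb : ∀ t (j : ℕ), (bvar a t j)^2 = ((κ^j)⁻¹)^2 * (κ^j * a t j - 1)^2 := by
    intro t j
    rw [bvar, hfix]
    field_simp
  have ha2 : ∀ t (j : ℕ), (a t j)^2 = ((κ^j)⁻¹)^2 * (κ^j * a t j)^2 := by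
    intro t j
    field_simp
  have hbs : ∀ t ∈ Ici (0:ℝ), Summable (fun j => (bvar a t j)^2) := by
    intro t ht
    refine Summable.of_nonneg_of_le (fun j => sq_nonneg _) (fun j => ?_)
      (((hsum t ht).mul_left 2).add (hgeo.mul_left 2))
    rw [bvar, hfix]
    nlinarith [sq_nonneg (a t j + (κ^j)⁻¹)]
  have hmain := fun n => core hκ1 hκ2 (fun t j => κ^j * a t j)
    (by
      intro t ht
      refine ((hode 0 t ht).const_mul (κ^0)).congr_deriv ?_
      simp only [dyadicRHS, hf0]
      field_simp
      ring)
    (by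
      intro j t ht
      refine ((hode (j+1) t ht).const_mul (κ^(j+1))).congr_deriv ?_
      simp only [dyadicRHS, hlk]
      ring)
    (fun j => mul_nonneg (by positivity) (h0 j))
    (C0 := ∑' j, (bvar a 0 j)^2) (C1 := ∑' j, (a 0 j)^2) (K := K)
    (by
      intro n
      simp only [← hb]
      exact (hbs 0 self_mem_Ici).sum_le_tsum _ (fun i _ => sq_nonneg _))
    (by
      intro n
      simp only [← ha2]
      exact (hsum 0 self_mem_Ici).sum_le_tsum _ (fun i _ => sq_nonneg _))
    hKpos hKle (T := t) ht n
  simp only [← hb] at hmain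
  have hC0nn : 0 ≤ ∑' j, (bvar a 0 j)^2 := tsum_nonneg (fun j => sq_nonneg _)
  have h1 : ∑' j, (bvar a t j)^2 ≤ (∑' j, (bvar a 0 j)^2) * Real.exp (-t/K) := by
    apply Real.tsum_le_of_sum_range_le (fun j => sq_nonneg _)
    intro n
    exact (Finset.sum_le_sum_of_subset_of_nonneg (Finset.range_mono (Nat.le_succ n))
      (fun i _ _ => sq_nonneg _)).trans (hmain n)
  refine h1.trans (mul_le_mul_of_nonneg_left (Real.exp_le_exp.2 ?_) hC0nn)
  have ht' : 0 ≤ t := ht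
  have h2 : (2 - lam ^ ((3:ℝ)/8)) / K * t ≤ 1 / K * t :=
    mul_le_mul_of_nonneg_right (div_le_div_of_nonneg_right (by linarith) hKpos.le) ht'
  have h3 : -t / K = -(1 / K * t) := by ring
  rw [h3]
  linarith
end
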